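/- Let (Ω, ℱ₂, P) be a probability space with sub-σ-algebra ℱ₁ ⊆ ℱ₂. Then ℱ₂ is atomless conditionally to ℱ₁ if and only if there exists an atomless sub-σ-algebra ℬ ⊆ ℱ₂ that is independent of ℱ₁. -/

import Mathlib

open MeasureTheory ProbabilityTheory

/-- The conditional expectation of the indicator of a set, as a real-valued function. -/
noncomputable def condIndicator {Ω : Type*} (m1 : MeasurableSpace Ω) [MeasurableSpace Ω]
    (μ : Measure Ω) (A : Set Ω) : Ω → ℝ :=
  μ[A.indicator (fun _ => (1 : ℝ)) | m1]

/-- The ambient σ-algebra is atomless conditionally to `m1`: for every measurable set `A`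
there is a measurable `B ⊆ A` with `0 < E[1_B ∣ m1] < E[1_A ∣ m1]` a.s. on
`{E[1_A ∣ m1] > 0}`. -/
def CondAtomless {Ω : Type*} (m1 : MeasurableSpace Ω) [MeasurableSpace Ω]
    (μ : Measure Ω) : Prop :=
  ∀ A : Set Ω, MeasurableSet A →
    ∃ B : Set Ω, MeasurableSet B ∧ B ⊆ A ∧
      ∀ᵐ ω ∂μ, 0 < condIndicator m1 μ A ω →
        0 < condIndicator m1 μ B ω ∧ condIndicator m1 μ B ω < condIndicator m1 μ A ω

/-- Two real random variables are commonotone if both are a.s. equal to nondecreasing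
functions of a common random variable. -/
def Commonotone {Ω : Type*} [MeasurableSpace Ω] (μ : Measure Ω) (ξ η : Ω → ℝ) : Prop :=
  ∃ (f g : ℝ → ℝ) (ζ : Ω → ℝ), Monotone f ∧ Monotone g ∧ Measurable ζ ∧
    ξ =ᵐ[μ] (fun ω => f (ζ ω)) ∧ η =ᵐ[μ] (fun ω => g (ζ ω))

/-- A sub-σ-algebra `mB` is atomless for `μ` if every `mB`-measurable set of positive
measure contains an `mB`-measurable subset of strictly smaller positive measure. -/
def SigmaAlgebraAtomless {Ω : Type*} (mB : MeasurableSpace Ω) [MeasurableSpace Ω]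
    (μ : Measure Ω) : Prop :=
  ∀ A : Set Ω, MeasurableSet[mB] A → 0 < μ A →
    ∃ B : Set Ω, MeasurableSet[mB] B ∧ B ⊆ A ∧ 0 < μ B ∧ μ B < μ A

section Exhaustion

/-- A property of sets that is stable under increasing countable unions admits a set that is
maximal up to null sets. -/
theorem exists_maximal_measure_of_iUnion {Ω : Type*} [MeasurableSpace Ω] (μ : Measure Ω)
    [IsFiniteMeasure μ] {P : Set Ω → Prop} (h0 : P ∅)
    (hU : ∀ B : ℕ → Set Ω, Monotone B → (∀ n, P (B n)) → P (⋃ n, B n)) :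
    ∃ B, P B ∧ ∀ C, P C → B ⊆ C → μ.real C ≤ μ.real B := by
  have step : ∀ B : {B // P B}, ∃ C : {C // P C}, B.1 ⊆ C.1 ∧
      ∀ D, P D → B.1 ⊆ D → μ.real D + μ.real B.1 ≤ 2 * μ.real C.1 := by
    intro B
    set S : Set ℝ := {x | ∃ D, P D ∧ B.1 ⊆ D ∧ μ.real D = x}
    have hbdd : BddAbove S := by
      refine ⟨μ.real Set.univ, ?_⟩
      rintro x ⟨D, -, -, rfl⟩
      exact measureReal_mono (Set.subset_univ _)
    have hBS : μ.real B.1 ∈ S := ⟨B.1, B.2, subset_rfl, rfl⟩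
    rcases (le_csSup hbdd hBS).eq_or_lt with h | h
    · refine ⟨B, subset_rfl, fun D hD hBD => ?_⟩
      have : μ.real D ≤ sSup S := le_csSup hbdd ⟨D, hD, hBD, rfl⟩
      linarith
    · obtain ⟨x, ⟨C, hC, hBC, rfl⟩, hx⟩ :=
        exists_lt_of_lt_csSup ⟨_, hBS⟩ (show (μ.real B.1 + sSup S) / 2 < sSup S by linarith)
      refine ⟨⟨C, hC⟩, hBC, fun D hD hBD => ?_⟩
      have : μ.real D ≤ sSup S := le_csSup hbdd ⟨D, hD, hBD, rfl⟩
      dsimp only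
      linarith
  choose next hsub hnext using step
  let B : ℕ → {B // P B} := fun n => Nat.rec ⟨∅, h0⟩ (fun _ C => next C) n
  have hmono : Monotone fun n => (B n).1 := monotone_nat_of_le_succ fun n => hsub (B n)
  refine ⟨⋃ n, (B n).1, hU _ hmono fun n => (B n).2, fun D hD hBD => ?_⟩
  have hlim : Filter.Tendsto (fun n => μ.real (B n).1) Filter.atTop
      (nhds (μ.real (⋃ n, (B n).1))) :=
    (ENNReal.tendsto_toReal (measure_ne_top _ _)).comp (tendsto_measure_iUnion_atTop hmono)
  have := le_of_tendsto_of_tendsto' (hlim.const_add (μ.real D))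
    ((hlim.comp (Filter.tendsto_add_atTop_nat 1)).const_mul 2)
    fun n => hnext (B n) D hD ((Set.subset_iUnion (fun n => (B n).1) n).trans hBD)
  linarith

end Exhaustion

section CondIndicator

variable {Ω : Type*} {m1 : MeasurableSpace Ω} [m2 : MeasurableSpace Ω] {μ : Measure Ω}

theorem measurable_condIndicator (A : Set Ω) : Measurable[m1] (condIndicator m1 μ A) :=
  stronglyMeasurable_condExp.measurable

theorem integrable_condIndicator (A : Set Ω) : Integrable (condIndicator m1 μ A) μ :=
  integrable_condExp

theorem condIndicator_nonneg (A : Set Ω) : 0 ≤ᵐ[μ] condIndicator m1 μ A :=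
  condExp_nonneg (.of_forall fun ω => Set.indicator_nonneg (fun _ _ => zero_le_one) ω)

theorem condIndicator_of_measure_eq_zero {A : Set Ω} (h : μ A = 0) :
    condIndicator m1 μ A =ᵐ[μ] 0 := by
  have : A.indicator (fun _ => (1 : ℝ)) =ᵐ[μ] 0 := indicator_meas_zero h
  simpa only [condIndicator, condExp_zero] using condExp_congr_ae (m := m1) this

variable [IsProbabilityMeasure μ]

theorem integrable_indicator_one {A : Set Ω} (hA : MeasurableSet A) :
    Integrable (A.indicator fun _ => (1 : ℝ)) μ :=
  (integrable_const 1).indicator hA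

theorem setIntegral_condIndicator (hm : m1 ≤ m2) {A D : Set Ω} (hA : MeasurableSet A)
    (hD : MeasurableSet[m1] D) : ∫ ω in D, condIndicator m1 μ A ω ∂μ = μ.real (A ∩ D) := by
  rw [condIndicator, setIntegral_condExp hm (integrable_indicator_one hA) hD,
    setIntegral_indicator hA, setIntegral_const, smul_eq_mul, mul_one, Set.inter_comm]

theorem condIndicator_mono {A B : Set Ω} (hA : MeasurableSet A) (hB : MeasurableSet B)
    (h : A ⊆ B) : condIndicator m1 μ A ≤ᵐ[μ] condIndicator m1 μ B :=
  condExp_mono (integrable_indicator_one hA) (integrable_indicator_one hB)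
    (.of_forall fun ω => Set.indicator_le_indicator_of_subset h (fun _ => zero_le_one) ω)

theorem condIndicator_univ (hm : m1 ≤ m2) :
    condIndicator m1 μ Set.univ = fun _ => (1 : ℝ) := by
  rw [condIndicator, Set.indicator_univ, condExp_const hm]

theorem condIndicator_le_one (hm : m1 ≤ m2) {A : Set Ω} (hA : MeasurableSet A) :
    ∀ᵐ ω ∂μ, condIndicator m1 μ A ω ≤ 1 := by
  filter_upwards [condIndicator_mono (m1 := m1) (μ := μ) hA .univ (Set.subset_univ A)] with ω h
  rwa [condIndicator_univ hm] at h

theorem condIndicator_union {A B : Set Ω} (hA : MeasurableSet A) (hB : MeasurableSet B)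
    (h : Disjoint A B) :
    condIndicator m1 μ (A ∪ B) =ᵐ[μ] condIndicator m1 μ A + condIndicator m1 μ B := by
  unfold condIndicator
  rw [Set.indicator_union_of_disjoint h]
  exact condExp_add (integrable_indicator_one hA) (integrable_indicator_one hB) m1

theorem condIndicator_diff {A B : Set Ω} (hA : MeasurableSet A) (hB : MeasurableSet B)
    (h : B ⊆ A) :
    ∀ᵐ ω ∂μ, condIndicator m1 μ (A \ B) ω = condIndicator m1 μ A ω - condIndicator m1 μ B ω := by
  have := condIndicator_union (m1 := m1) (μ := μ) hB (hA.diff hB) Set.disjoint_sdiff_right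
  rw [Set.union_sdiff_cancel h] at this
  filter_upwards [this] with ω hω
  rw [hω, Pi.add_apply]
  ring

theorem condIndicator_inter {A D : Set Ω} (hA : MeasurableSet A) (hD : MeasurableSet[m1] D) :
    condIndicator m1 μ (A ∩ D) =ᵐ[μ] D.indicator (condIndicator m1 μ A) := by
  unfold condIndicator
  rw [Set.inter_comm, ← Set.indicator_indicator]
  exact condExp_indicator (integrable_indicator_one hA) hD

theorem measure_inter_eq_zero_iff (hm : m1 ≤ m2) {A D : Set Ω} (hA : MeasurableSet A)
    (hD : MeasurableSet[m1] D) :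
    μ (A ∩ D) = 0 ↔ ∀ᵐ ω ∂μ, ω ∈ D → condIndicator m1 μ A ω = 0 := by
  constructor
  · intro h
    filter_upwards [condIndicator_inter (μ := μ) hA hD,
      condIndicator_of_measure_eq_zero (m1 := m1) h] with ω h1 h2 hω
    rwa [h2, Set.indicator_of_mem hω, eq_comm] at h1
  · intro h
    rw [← measureReal_eq_zero_iff, ← setIntegral_condIndicator hm hA hD,
      setIntegral_congr_ae (hm _ hD) h, integral_zero]

theorem two_mul_condIndicator_le_iff (hm : m1 ≤ m2) {A B : Set Ω} (hA : MeasurableSet A)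
    (hB : MeasurableSet B) :
    (∀ᵐ ω ∂μ, 2 * condIndicator m1 μ B ω ≤ condIndicator m1 μ A ω) ↔
      ∀ D, MeasurableSet[m1] D → 2 * μ.real (B ∩ D) ≤ μ.real (A ∩ D) := by
  constructor
  · intro h D hD
    rw [← setIntegral_condIndicator hm hA hD, ← setIntegral_condIndicator hm hB hD,
      ← integral_const_mul]
    exact setIntegral_mono_ae ((integrable_condIndicator B).const_mul 2).integrableOn
      (integrable_condIndicator A).integrableOn h
  · intro h
    set f : Ω → ℝ := fun ω => 2 * condIndicator m1 μ B ω - condIndicator m1 μ A ω with hf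
    have hfi : Integrable f μ :=
      ((integrable_condIndicator B).const_mul 2).sub (integrable_condIndicator A)
    have hfm : Measurable[m1] f :=
      ((measurable_condIndicator B).const_mul 2).sub (measurable_condIndicator A)
    set G : Set Ω := {ω | 0 < f ω}
    have hG : MeasurableSet[m1] G := hfm measurableSet_Ioi
    have hint : ∫ ω in G, f ω ∂μ ≤ 0 := by
      rw [hf, integral_sub ((integrable_condIndicator B).const_mul 2).integrableOn
        (integrable_condIndicator A).integrableOn, integral_const_mul,
        setIntegral_condIndicator hm hA hG, setIntegral_condIndicator hm hB hG]
      linarith [h G hG]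
    have hz : μ G = 0 := by
      by_contra hne
      refine hint.not_gt ((setIntegral_pos_iff_support_of_nonneg_ae ?_ hfi.integrableOn).2 ?_)
      · exact (ae_restrict_iff' (hm _ hG)).2 (.of_forall fun ω hω => le_of_lt hω)
      · have : G ⊆ Function.support f := fun ω hω => ne_of_gt hω
        rw [Set.inter_eq_right.2 this]
        exact pos_iff_ne_zero.2 hne
    filter_upwards [measure_eq_zero_iff_ae_notMem.1 hz] with ω hω
    simp only [G, f, Set.mem_ofPred_eq, not_lt] at hω
    linarith

/-- Measurable selection among countably many sets: on `⋃ i, E i` the glued set has the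
conditional probability of one of the admissible pieces, and it vanishes elsewhere. -/
theorem exists_glue {ι : Type*} [Countable ι] [Nonempty ι] (hm : m1 ≤ m2) {C E : ι → Set Ω}
    (hC : ∀ i, MeasurableSet (C i)) (hE : ∀ i, MeasurableSet[m1] (E i)) :
    ∃ B, MeasurableSet B ∧ B ⊆ ⋃ i, C i ∧
      ∀ᵐ ω ∂μ, (∃ i, ω ∈ E i ∧ condIndicator m1 μ B ω = condIndicator m1 μ (C i) ω) ∨
        (condIndicator m1 μ B ω = 0 ∧ ∀ i, ω ∉ E i) := by
  obtain ⟨e, he⟩ := exists_surjective_nat ι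
  set D : ℕ → Set Ω := disjointed fun n => E (e n) with hDdef
  have hD : ∀ n, MeasurableSet[m1] (D n) := fun n =>
    MeasurableSet.disjointed (fun n => hE (e n)) n
  have hDU : ⋃ n, D n = ⋃ n, E (e n) := iUnion_disjointed
  have hdisj : Pairwise (Function.onFun Disjoint D) := disjoint_disjointed _
  set B : Set Ω := ⋃ n, C (e n) ∩ D n with hBdef
  have hB : MeasurableSet B := .iUnion fun n => (hC _).inter (hm _ (hD n))
  have hBD : ∀ n, B ∩ D n = C (e n) ∩ D n := by
    intro n
    ext ω
    simp only [hBdef, Set.mem_inter_iff, Set.mem_iUnion]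
    constructor
    · rintro ⟨⟨k, hk, hkD⟩, hn⟩
      obtain rfl : k = n := by
        by_contra hne
        exact Set.disjoint_left.1 (hdisj hne) hkD hn
      exact ⟨hk, hn⟩
    · rintro ⟨h, hn⟩
      exact ⟨⟨n, h, hn⟩, hn⟩
  have hUc : MeasurableSet[m1] (⋃ n, D n)ᶜ := (MeasurableSet.iUnion hD).compl
  have hempty : B ∩ (⋃ n, D n)ᶜ = ∅ := by
    rw [← Set.sdiff_eq, Set.sdiff_eq_empty]
    exact Set.iUnion_mono fun n => Set.inter_subset_right
  have hoff := (measure_inter_eq_zero_iff hm hB hUc).1 (by rw [hempty]; exact measure_empty (μ := μ))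
  refine ⟨B, hB, Set.iUnion_subset fun n => Set.inter_subset_left.trans
    (Set.subset_iUnion C (e n)), ?_⟩
  filter_upwards [hoff, ae_all_iff.2 fun n => condIndicator_inter (μ := μ) hB (hD n),
    ae_all_iff.2 fun n => condIndicator_inter (μ := μ) (hC (e n)) (hD n)] with ω h0 h1 h2
  by_cases hω : ω ∈ ⋃ n, D n
  · obtain ⟨n, hn⟩ := Set.mem_iUnion.1 hω
    refine .inl ⟨e n, disjointed_subset _ n hn, ?_⟩
    have h1 := h1 n
    have h2 := h2 n
    rw [Set.indicator_of_mem hn] at h1 h2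
    rw [← h1, ← h2, hBD]
  · refine .inr ⟨h0 hω, fun i hi => hω ?_⟩
    obtain ⟨n, rfl⟩ := he i
    rw [hDU]
    exact Set.mem_iUnion.2 ⟨n, hi⟩

/-- A countable cover has, at almost every point where `A` has positive conditional probability,
a member meeting `A` with positive conditional probability. -/
theorem ae_exists_condIndicator_inter_pos {ι : Type*} [Countable ι] (hm : m1 ≤ m2) {A : Set Ω}
    {C : ι → Set Ω} (hA : MeasurableSet A) (hC : ∀ i, MeasurableSet (C i))
    (hAC : A ⊆ ⋃ i, C i) :
    ∀ᵐ ω ∂μ, 0 < condIndicator m1 μ A ω → ∃ i, 0 < condIndicator m1 μ (A ∩ C i) ω := by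
  set G : Set Ω := ⋂ i, {ω | condIndicator m1 μ (A ∩ C i) ω ≤ 0}
  have hG : MeasurableSet[m1] G :=
    MeasurableSet.iInter fun i => measurable_condIndicator _ measurableSet_Iic
  have hz : μ (A ∩ G) = 0 := by
    refine measure_mono_null (t := ⋃ i, A ∩ C i ∩ G) ?_ (measure_iUnion_null fun i => ?_)
    · rintro ω ⟨hA, hG⟩
      obtain ⟨i, hi⟩ := Set.mem_iUnion.1 (hAC hA)
      exact Set.mem_iUnion.2 ⟨i, ⟨hA, hi⟩, hG⟩
    · refine (measure_inter_eq_zero_iff hm (hA.inter (hC i)) hG).2 ?_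
      filter_upwards [condIndicator_nonneg (m1 := m1) (μ := μ) (A ∩ C i)] with ω h hω
      exact le_antisymm (Set.mem_iInter.1 hω i) h
  filter_upwards [(measure_inter_eq_zero_iff hm hA hG).1 hz] with ω h hpos
  by_contra! hcon
  exact hpos.ne' (h (Set.mem_iInter.2 hcon))

theorem CondAtomless.exists_small (hm : m1 ≤ m2) (h : CondAtomless m1 μ) {A : Set Ω}
    (hA : MeasurableSet A) (n : ℕ) :
    ∃ B, MeasurableSet B ∧ B ⊆ A ∧ ∀ᵐ ω ∂μ, 0 < condIndicator m1 μ A ω →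
      0 < condIndicator m1 μ B ω ∧ condIndicator m1 μ B ω ≤ (1 / 2) ^ n := by
  induction n with
  | zero =>
    refine ⟨A, hA, subset_rfl, ?_⟩
    filter_upwards [condIndicator_le_one hm hA] with ω h1 h0
    exact ⟨h0, by simpa using h1⟩
  | succ n ih =>
    obtain ⟨B, hB, hBA, hBn⟩ := ih
    obtain ⟨C, hC, hCB, hCpos⟩ := h B hB
    let K : Bool → Set Ω := fun b => if b then C else B \ C
    have hK : ∀ b, MeasurableSet (K b) := by rintro (_ | _) <;> simp [K, hC, hB.diff hC]
    let E : Bool → Set Ω := fun b => {ω | 0 < condIndicator m1 μ (K b) ω} ∩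
      {ω | condIndicator m1 μ (K b) ω ≤ condIndicator m1 μ B ω / 2}
    have hE : ∀ b, MeasurableSet[m1] (E b) := fun b =>
      (measurable_condIndicator _ measurableSet_Ioi).inter
        (measurableSet_le (measurable_condIndicator _)
          ((measurable_condIndicator _).div_const 2))
    obtain ⟨F, hF, hFK, hFE⟩ := exists_glue (μ := μ) hm hK hE
    have hKB : ⋃ b, K b ⊆ B :=
      Set.iUnion_subset (by rintro (_ | _) <;> simp [K, hCB])
    refine ⟨F, hF, hFK.trans (hKB.trans hBA), ?_⟩
    filter_upwards [hBn, hCpos, hFE, condIndicator_diff (m1 := m1) (μ := μ) hB hC hCB] with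
      ω hBω hCω hFω hdiff hpos
    obtain ⟨hB0, hBle⟩ := hBω hpos
    obtain ⟨hC0, hClt⟩ := hCω hB0
    rcases hFω with ⟨b, ⟨hb0, hbB⟩, hbF⟩ | ⟨-, hno⟩
    · simp only [Set.mem_ofPred_eq] at hb0 hbB
      rw [hbF, pow_succ]
      exact ⟨hb0, by linarith⟩
    · exfalso
      rcases le_total (condIndicator m1 μ C ω) (condIndicator m1 μ B ω / 2) with hle | hle
      · exact hno true ⟨by simpa [K] using hC0, by simpa [K] using hle⟩
      · refine hno false ⟨?_, ?_⟩
        · simp only [K, Bool.false_eq_true, if_false, Set.mem_ofPred_eq, hdiff]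
          linarith
        · simp only [K, Bool.false_eq_true, if_false, Set.mem_ofPred_eq, hdiff]
          linarith

theorem CondAtomless.exists_half (hm : m1 ≤ m2) (h : CondAtomless m1 μ) {A : Set Ω}
    (hA : MeasurableSet A) :
    ∃ B, MeasurableSet B ∧ B ⊆ A ∧
      ∀ᵐ ω ∂μ, condIndicator m1 μ B ω = condIndicator m1 μ A ω / 2 := by
  obtain ⟨B, ⟨hB, hBA, hBD⟩, hmax⟩ := exists_maximal_measure_of_iUnion μ
    (P := fun B => MeasurableSet B ∧ B ⊆ A ∧
      ∀ D, MeasurableSet[m1] D → 2 * μ.real (B ∩ D) ≤ μ.real (A ∩ D))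
    ⟨.empty, Set.empty_subset A, fun D _ => by simp⟩ (by
      intro B hmono hB
      refine ⟨.iUnion fun n => (hB n).1, Set.iUnion_subset fun n => (hB n).2.1, fun D hD => ?_⟩
      have hmono' : Monotone fun n => B n ∩ D := fun i j hij =>
        Set.inter_subset_inter_left D (hmono hij)
      have hlim := (ENNReal.tendsto_toReal (measure_ne_top _ _)).comp
        (tendsto_measure_iUnion_atTop (μ := μ) hmono')
      rw [← Set.iUnion_inter] at hlim
      exact le_of_tendsto' (hlim.const_mul 2) fun n => (hB n).2.2 D hD)
  have hle := (two_mul_condIndicator_le_iff hm hA hB).2 hBD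
  choose S hS hSsub hSpos using fun n => h.exists_small hm (hA.diff hB) n
  let E : ℕ → Set Ω := fun n => {ω | 0 < condIndicator m1 μ (S n) ω} ∩
    {ω | 2 * condIndicator m1 μ (S n) ω ≤ condIndicator m1 μ A ω - 2 * condIndicator m1 μ B ω}
  have hE : ∀ n, MeasurableSet[m1] (E n) := fun n =>
    (measurable_condIndicator _ measurableSet_Ioi).inter
      (measurableSet_le ((measurable_condIndicator _).const_mul 2)
        ((measurable_condIndicator _).sub ((measurable_condIndicator _).const_mul 2)))
  obtain ⟨C, hC, hCS, hCE⟩ := exists_glue (μ := μ) hm hS hE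
  have hCsub : C ⊆ A \ B := hCS.trans (Set.iUnion_subset hSsub)
  have hdisj : Disjoint B C := Set.disjoint_sdiff_right.mono_right hCsub
  have hunion : ∀ᵐ ω ∂μ, 2 * condIndicator m1 μ (B ∪ C) ω ≤ condIndicator m1 μ A ω := by
    filter_upwards [hle, hCE, condIndicator_union (m1 := m1) (μ := μ) hB hC hdisj] with ω h1 h2 h3
    rw [h3, Pi.add_apply]
    rcases h2 with ⟨n, ⟨-, hn⟩, hCn⟩ | ⟨h0, -⟩
    · simp only [Set.mem_ofPred_eq] at hn
      linarith
    · linarith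
  have hCzero : μ C = 0 := by
    have := hmax (B ∪ C) ⟨hB.union hC, Set.union_subset hBA (hCsub.trans Set.sdiff_subset),
      (two_mul_condIndicator_le_iff hm hA (hB.union hC)).1 hunion⟩ Set.subset_union_left
    rw [measureReal_union hdisj hC] at this
    rw [← measureReal_eq_zero_iff]
    exact le_antisymm (by linarith) measureReal_nonneg
  refine ⟨B, hB, hBA, ?_⟩
  filter_upwards [hle, hCE, condIndicator_of_measure_eq_zero (m1 := m1) hCzero,
    condIndicator_diff (m1 := m1) (μ := μ) hA hB hBA, ae_all_iff.2 hSpos,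
    condIndicator_nonneg (m1 := m1) (μ := μ) B] with ω h1 h2 h3 h4 h5 h6
  by_contra hne
  have hlt : 0 < condIndicator m1 μ A ω - 2 * condIndicator m1 μ B ω := by
    refine lt_of_le_of_ne (by linarith) fun h => hne (by linarith)
  have hpos : 0 < condIndicator m1 μ (A \ B) ω := by
    simp only [Pi.zero_apply] at h6
    linarith
  rcases h2 with ⟨n, ⟨hn0, -⟩, hCn⟩ | ⟨-, hno⟩
  · simp only [Set.mem_ofPred_eq, ← hCn, h3, Pi.zero_apply, lt_irrefl] at hn0
  · obtain ⟨n, hn⟩ := exists_pow_lt_of_lt_one (half_pos hlt) (show (1 / 2 : ℝ) < 1 by norm_num)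
    obtain ⟨hn0, hnle⟩ := h5 n hpos
    exact hno n ⟨hn0, by simp only [Set.mem_ofPred_eq]; linarith⟩

end CondIndicator

section DyadicTree

/-- A binary tree of sets, rooted at the whole space, each node being split by its two children;
nodes are indexed by the word leading to them, last letter first. -/
structure IsDyadicTree {Ω : Type*} (T : List Bool → Set Ω) : Prop where
  nil : T [] = Set.univ
  union : ∀ s, T (true :: s) ∪ T (false :: s) = T s
  disjoint : ∀ s, Disjoint (T (true :: s)) (T (false :: s))

variable {Ω : Type*} {T : List Bool → Set Ω}

theorem IsDyadicTree.cons_subset (hT : IsDyadicTree T) (b : Bool) (s : List Bool) :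
    T (b :: s) ⊆ T s := by
  rw [← hT.union s]
  cases b
  · exact Set.subset_union_right
  · exact Set.subset_union_left

theorem IsDyadicTree.append_subset (hT : IsDyadicTree T) (u s : List Bool) :
    T (u ++ s) ⊆ T s := by
  induction u with
  | nil => rfl
  | cons b u ih => exact (hT.cons_subset b _).trans ih

theorem IsDyadicTree.eq_of_mem (hT : IsDyadicTree T) {ω : Ω} :
    ∀ {s t : List Bool}, s.length = t.length → ω ∈ T s → ω ∈ T t → s = t
  | [], [], _, _, _ => rfl
  | b :: s, c :: t, hl, hs, ht => by
    obtain rfl := hT.eq_of_mem (Nat.succ.inj hl) (hT.cons_subset b s hs) (hT.cons_subset c t ht)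
    have := Set.disjoint_left.1 (hT.disjoint s)
    cases b <;> cases c
    · rfl
    · exact absurd hs (this ht)
    · exact absurd ht (this hs)
    · rfl

theorem IsDyadicTree.exists_mem (hT : IsDyadicTree T) (ω : Ω) (n : ℕ) :
    ∃ s : List Bool, s.length = n ∧ ω ∈ T s := by
  induction n with
  | zero => exact ⟨[], rfl, by simp [hT.nil]⟩
  | succ n ih =>
    obtain ⟨s, rfl, hs⟩ := ih
    rw [← hT.union s] at hs
    rcases hs with hs | hs
    · exact ⟨true :: s, rfl, hs⟩
    · exact ⟨false :: s, rfl, hs⟩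

theorem IsDyadicTree.subset_of_length_le (hT : IsDyadicTree T) {s t : List Bool} {ω : Ω}
    (hl : t.length ≤ s.length) (hs : ω ∈ T s) (ht : ω ∈ T t) : T s ⊆ T t := by
  have happ := List.take_append_drop (s.length - t.length) s
  have hd : s.drop (s.length - t.length) = t := by
    refine hT.eq_of_mem (by simp; omega) (hT.append_subset (s.take (s.length - t.length)) _ ?_) ht
    rwa [happ]
  rw [← happ, hd]
  exact hT.append_subset _ _

theorem IsDyadicTree.isPiSystem (hT : IsDyadicTree T) : IsPiSystem (Set.range T) := by
  rintro _ ⟨s, rfl⟩ _ ⟨t, rfl⟩ ⟨ω, hs, ht⟩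
  rcases le_total t.length s.length with hl | hl
  · exact ⟨s, (Set.inter_eq_left.2 (hT.subset_of_length_le hl hs ht)).symm⟩
  · exact ⟨t, (Set.inter_eq_right.2 (hT.subset_of_length_le hl ht hs)).symm⟩

theorem CondAtomless.exists_isDyadicTree {m1 : MeasurableSpace Ω} [m2 : MeasurableSpace Ω]
    {μ : Measure Ω} [IsProbabilityMeasure μ] (hm : m1 ≤ m2) (h : CondAtomless m1 μ) :
    ∃ T : List Bool → Set Ω, IsDyadicTree T ∧ (∀ s, MeasurableSet (T s)) ∧
      ∀ s, ∀ᵐ ω ∂μ, condIndicator m1 μ (T s) ω = (1 / 2) ^ s.length := by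
  choose H hH hsub hhalf using fun A : {A : Set Ω // MeasurableSet A} => h.exists_half hm A.2
  let T : List Bool → {A : Set Ω // MeasurableSet A} := fun s => List.rec ⟨Set.univ, .univ⟩
    (fun b _ A => if b then ⟨H A, hH A⟩ else ⟨A.1 \ H A, A.2.diff (hH A)⟩) s
  have htrue : ∀ s, (T (true :: s)).1 = H (T s) := fun s => rfl
  have hfalse : ∀ s, (T (false :: s)).1 = (T s).1 \ H (T s) := fun s => rfl
  refine ⟨fun s => (T s).1, ⟨rfl, fun s => ?_, fun s => ?_⟩, fun s => (T s).2, fun s => ?_⟩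
  · rw [htrue, hfalse, Set.union_sdiff_cancel (hsub _)]
  · rw [htrue, hfalse]
    exact Set.disjoint_sdiff_right
  · induction s with
    | nil => exact .of_forall fun ω => by simpa [T] using congrFun (condIndicator_univ hm) ω
    | cons b s ih =>
      filter_upwards [ih, hhalf (T s), condIndicator_diff (m1 := m1) (μ := μ) (T s).2 (hH (T s))
        (hsub (T s))] with ω h1 h2 h3
      cases b
      · rw [hfalse, h3, h2, h1, List.length_cons, pow_succ]
        ring
      · rw [htrue, h2, h1, List.length_cons, pow_succ]
        ring

theorem IsDyadicTree.measureReal_inter {m1 : MeasurableSpace Ω} [m2 : MeasurableSpace Ω]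
    {μ : Measure Ω} [IsProbabilityMeasure μ] (hm : m1 ≤ m2) {s : List Bool}
    (hs : MeasurableSet (T s))
    (hc : ∀ᵐ ω ∂μ, condIndicator m1 μ (T s) ω = (1 / 2) ^ s.length) {D : Set Ω}
    (hD : MeasurableSet[m1] D) : μ.real (T s ∩ D) = (1 / 2) ^ s.length * μ.real D := by
  rw [← setIntegral_condIndicator hm hs hD,
    setIntegral_congr_ae (hm _ hD) (hc.mono fun ω h _ => h), setIntegral_const, smul_eq_mul,
    mul_comm]

end DyadicTree

section Equivalence

variable {Ω : Type*} {m1 mB : MeasurableSpace Ω} [m2 : MeasurableSpace Ω] {μ : Measure Ω}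
  [IsProbabilityMeasure μ]

theorem CondAtomless.exists_atomless_indep (hm : m1 ≤ m2) (h : CondAtomless m1 μ) :
    ∃ mB : MeasurableSpace Ω, mB ≤ m2 ∧ @SigmaAlgebraAtomless Ω mB m2 μ ∧
      @Indep Ω mB m1 m2 μ := by
  obtain ⟨T, hT, hTm, hTc⟩ := h.exists_isDyadicTree hm
  have hreal : ∀ s, μ.real (T s) = (1 / 2) ^ s.length := fun s => by
    simpa using IsDyadicTree.measureReal_inter hm (hTm s) (hTc s) (D := Set.univ) .univ
  have hgen : MeasurableSpace.generateFrom (Set.range T) ≤ m2 :=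
    MeasurableSpace.generateFrom_le (by rintro _ ⟨s, rfl⟩; exact hTm s)
  refine ⟨MeasurableSpace.generateFrom (Set.range T), hgen, fun A hA hpos => ?_, ?_⟩
  · have hposr : 0 < μ.real A := ENNReal.toReal_pos hpos.ne' (measure_ne_top _ _)
    obtain ⟨n, hn⟩ := exists_pow_lt_of_lt_one hposr (show (1 / 2 : ℝ) < 1 by norm_num)
    have : ∃ s : List Bool, s.length = n ∧ 0 < μ (A ∩ T s) := by
      by_contra! hcon
      refine hpos.ne' (measure_mono_null (t := ⋃ s : {s : List Bool // s.length = n}, A ∩ T s)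
        (fun ω hω => ?_) (measure_iUnion_null fun s => le_antisymm (hcon s s.2) (zero_le)))
      obtain ⟨s, hs, hωs⟩ := hT.exists_mem ω n
      exact Set.mem_iUnion.2 ⟨⟨s, hs⟩, hω, hωs⟩
    obtain ⟨s, rfl, hs⟩ := this
    refine ⟨A ∩ T s, MeasurableSet.inter hA (MeasurableSpace.measurableSet_generateFrom ⟨s, rfl⟩),
      Set.inter_subset_left, hs, ?_⟩
    rw [← ENNReal.toReal_lt_toReal (measure_ne_top _ _) (measure_ne_top _ _)]
    calc μ.real (A ∩ T s) ≤ μ.real (T s) := measureReal_mono Set.inter_subset_right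
      _ = (1 / 2) ^ s.length := hreal s
      _ < μ.real A := hn
  · refine IndepSets.indep hgen hm hT.isPiSystem (@MeasurableSpace.isPiSystem_measurableSet Ω m1)
      rfl (@MeasurableSpace.generateFrom_measurableSet Ω m1).symm ?_
    rw [IndepSets_iff]
    rintro _ D ⟨s, rfl⟩ hD
    rw [← ENNReal.toReal_eq_toReal_iff' (measure_ne_top _ _)
      (ENNReal.mul_ne_top (measure_ne_top _ _) (measure_ne_top _ _)), ENNReal.toReal_mul]
    change μ.real (T s ∩ D) = μ.real (T s) * μ.real D
    rw [hreal, IsDyadicTree.measureReal_inter hm (hTm s) (hTc s) hD]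

theorem isProbabilityMeasure_trim (hm : m1 ≤ m2) :
    @IsProbabilityMeasure Ω m1 (μ.trim hm) :=
  @IsProbabilityMeasure.mk Ω m1 _ (by rw [trim_measurableSet_eq hm .univ, measure_univ])

theorem SigmaAlgebraAtomless.condAtomless_bot_trim (hB : mB ≤ m2)
    (h : @SigmaAlgebraAtomless Ω mB m2 μ) : @CondAtomless Ω ⊥ mB (μ.trim hB) := by
  have hprob : @IsProbabilityMeasure Ω mB (μ.trim hB) := isProbabilityMeasure_trim hB
  have hcond : ∀ A, MeasurableSet[mB] A →
      @condIndicator Ω ⊥ mB (μ.trim hB) A = fun _ => μ.real A := by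
    intro A hA
    rw [condIndicator, condExp_bot, integral_indicator hA, setIntegral_const, smul_eq_mul, mul_one,
      measureReal_def, trim_measurableSet_eq hB hA, measureReal_def]
  intro A hA
  rcases (zero_le (a := μ A)).eq_or_lt with hz | hpos
  · refine ⟨A, hA, subset_rfl, .of_forall fun ω hω => ?_⟩
    simp [hcond A hA, measureReal_def, ← hz] at hω
  · obtain ⟨B, hBm, hBA, hB0, hBlt⟩ := h A hA hpos
    refine ⟨B, hBm, hBA, .of_forall fun ω _ => ?_⟩
    rw [hcond A hA, hcond B hBm]
    exact ⟨ENNReal.toReal_pos hB0.ne' (measure_ne_top _ _),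
      (ENNReal.toReal_lt_toReal (measure_ne_top _ _) (measure_ne_top _ _)).2 hBlt⟩

theorem SigmaAlgebraAtomless.condAtomless (hm : m1 ≤ m2) (hB : mB ≤ m2)
    (h : @SigmaAlgebraAtomless Ω mB m2 μ) (hind : @Indep Ω mB m1 m2 μ) : CondAtomless m1 μ := by
  obtain ⟨T, hT, hTB, hTc⟩ :=
    @CondAtomless.exists_isDyadicTree Ω ⊥ mB (μ.trim hB) (isProbabilityMeasure_trim hB) bot_le
      (h.condAtomless_bot_trim hB)
  have hTm : ∀ s, MeasurableSet (T s) := fun s => hB _ (hTB s)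
  have hreal : ∀ s, μ.real (T s) = (1 / 2) ^ s.length := by
    intro s
    have := @IsDyadicTree.measureReal_inter Ω T ⊥ mB (μ.trim hB) (isProbabilityMeasure_trim hB)
      bot_le s (hTB s) (hTc s) Set.univ .univ
    have hprob : @IsProbabilityMeasure Ω mB (μ.trim hB) := isProbabilityMeasure_trim hB
    rwa [Set.inter_univ, probReal_univ, mul_one, measureReal_def,
      trim_measurableSet_eq hB (hTB s)] at this
  have hcond : ∀ s, ∀ᵐ ω ∂μ, condIndicator m1 μ (T s) ω = (1 / 2) ^ s.length := by
    intro s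
    filter_upwards [condExp_indep_eq hB hm (f := (T s).indicator fun _ => (1 : ℝ))
      (stronglyMeasurable_const.indicator (hTB s)) hind] with ω hω
    rw [condIndicator, hω, integral_indicator (hTm s), setIntegral_const, smul_eq_mul, mul_one,
      hreal]
  intro A hA
  have hAT : ∀ s, MeasurableSet (A ∩ T s) := fun s => hA.inter (hTm s)
  let E : List Bool → Set Ω := fun s => {ω | 0 < condIndicator m1 μ (A ∩ T s) ω} ∩
    {ω | condIndicator m1 μ (A ∩ T s) ω < condIndicator m1 μ A ω}
  have hE : ∀ s, MeasurableSet[m1] (E s) := fun s =>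
    (measurable_condIndicator _ measurableSet_Ioi).inter
      (measurableSet_lt (measurable_condIndicator _)
        (measurable_condIndicator _))
  obtain ⟨B, hBm, hBA, hBE⟩ := exists_glue (μ := μ) hm hAT hE
  refine ⟨B, hBm, hBA.trans (Set.iUnion_subset fun s => Set.inter_subset_left), ?_⟩
  have hcover : ∀ n, ∀ᵐ ω ∂μ, 0 < condIndicator m1 μ A ω →
      ∃ s : {s : List Bool // s.length = n}, 0 < condIndicator m1 μ (A ∩ T s) ω := fun n =>
    ae_exists_condIndicator_inter_pos hm hA (fun s => hTm s) fun ω _ => by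
      obtain ⟨s, hs, hω⟩ := hT.exists_mem ω n
      exact Set.mem_iUnion.2 ⟨⟨s, hs⟩, hω⟩
  filter_upwards [hBE, ae_all_iff.2 hcover, ae_all_iff.2 hcond, ae_all_iff.2 fun s =>
    condIndicator_mono (m1 := m1) (μ := μ) (hAT s) (hTm s) Set.inter_subset_right] with
    ω hω hcov hc hle hpos
  rcases hω with ⟨s, ⟨hs0, hslt⟩, hBs⟩ | ⟨-, hno⟩
  · rw [hBs]
    exact ⟨hs0, hslt⟩
  · obtain ⟨n, hn⟩ := exists_pow_lt_of_lt_one hpos (show (1 / 2 : ℝ) < 1 by norm_num)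
    obtain ⟨⟨s, rfl⟩, hs⟩ := hcov n hpos
    exact absurd ⟨hs, (hle s).trans_lt ((hc s).trans_lt hn)⟩ (hno s)

end Equivalence

theorem condAtomless_iff_exists_atomless_indep {Ω : Type*} (m1 : MeasurableSpace Ω)
    [m2 : MeasurableSpace Ω] (hm : m1 ≤ m2) (μ : Measure Ω) [IsProbabilityMeasure μ] :
    CondAtomless m1 μ ↔
      ∃ mB : MeasurableSpace Ω, mB ≤ m2 ∧ @SigmaAlgebraAtomless Ω mB m2 μ ∧ @Indep Ω mB m1 m2 μ :=
  ⟨fun h => h.exists_atomless_indep hm, fun ⟨mB, hB, hat, hind⟩ =>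
    @SigmaAlgebraAtomless.condAtomless Ω m1 mB m2 μ _ hm hB hat hind⟩
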